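/- arXiv:2007.13550 — 5 statements merged into one kernel-verified Lean document; each statement's English description precedes it below -/
import Mathlib

section
/- If B is a Bernstein set and K is a proper subfield of ℝ with B ⊆ K, then K is a Bernstein field, i.e. K is itself a Bernstein set. -/
noncomputable section

open Set Cardinal

/-- A Cantor set: a nonempty compact subset of ℝ that is totally disconnected
and dense in itself (no isolated points). -/
def IsCantorSet (C : Set ℝ) : Prop :=
  C.Nonempty ∧ IsCompact C ∧ IsTotallyDisconnected C ∧ Preperfect C

/-- A Bernstein set: neither it nor its complement contains a Cantor set. -/
def IsBernsteinSet (B : Set ℝ) : Prop :=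
  (¬ ∃ C ⊆ B, IsCantorSet C) ∧ (¬ ∃ C ⊆ Bᶜ, IsCantorSet C)

/-- Translates of Cantor sets are Cantor sets. -/
theorem IsCantorSet.image_add_left {C : Set ℝ} (hC : IsCantorSet C) (t : ℝ) :
    IsCantorSet ((t + ·) '' C) := by
  obtain ⟨hne, hcomp, htd, hperf⟩ := hC
  refine ⟨hne.image _, hcomp.image (by fun_prop),
    (Homeomorph.addLeft t).isEmbedding.isTotallyDisconnected_image.2 htd, ?_⟩
  rintro _ ⟨x, hx, rfl⟩
  simpa using (hperf x hx).map (continuous_const_add t).continuousAt (add_right_injective t)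

/-- If a proper subfield K of ℝ contains a Bernstein set, then K is a
Bernstein set. -/
theorem bernstein_field_of_contains_bernstein (B : Set ℝ) (hB : IsBernsteinSet B)
    (K : Subfield ℝ) (hK : K ≠ ⊤) (hBK : B ⊆ (K : Set ℝ)) :
    IsBernsteinSet (K : Set ℝ) := by
  refine ⟨?_, fun ⟨C, hCK, hC⟩ => hB.2 ⟨C, hCK.trans (compl_subset_compl.2 hBK), hC⟩⟩
  rintro ⟨C, hCK, hC⟩
  obtain ⟨t, ht⟩ : ∃ t, t ∉ K := by
    by_contra! h
    exact hK (eq_top_iff.2 fun x _ => h x)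
  refine hB.2 ⟨_, ?_, hC.image_add_left t⟩
  rintro _ ⟨x, hx, rfl⟩ hxB
  exact ht (by simpa using K.sub_mem (hBK hxB) (hCK hx))
end
end

section
/- If B is a Bernstein set and S ⊆ ℝ is algebraically independent with B ⊆ S, then S is a Bernstein set and the subfield ℚ(S) of ℝ generated by S is a Bernstein field (in particular ℚ(S) ≠ ℝ and ℚ(S) is a Bernstein set). -/
noncomputable section

open Set Cardinal

/-- A set `S ⊆ ℝ` is algebraically independent (over ℚ). -/
def AlgIndepSet (S : Set ℝ) : Prop := AlgebraicIndependent ℚ ((↑) : S → ℝ)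

theorem IsCantorSet.image_homeomorph {C : Set ℝ} (hC : IsCantorSet C) (e : ℝ ≃ₜ ℝ) :
    IsCantorSet (e '' C) := by
  obtain ⟨hne, hc, htd, hp⟩ := hC
  refine ⟨hne.image e, hc.image e.continuous,
    e.isEmbedding.isTotallyDisconnected_image.2 htd, ?_⟩
  rintro _ ⟨x, hx, rfl⟩
  have h := (hp x hx).map e.continuous.continuousAt e.injective
  rwa [Filter.map_principal] at h

theorem MvPolynomial.sq_ne_two_mul_sq {σ : Type*} {p q : MvPolynomial σ ℚ} (hq : q ≠ 0) :
    p ^ 2 ≠ 2 * q ^ 2 := by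
  intro h
  have hdvd : q ∣ p :=
    (IsIntegrallyClosed.pow_dvd_pow_iff two_ne_zero).1 ⟨2, by rw [h, mul_comm]⟩
  obtain ⟨r, rfl⟩ := hdvd
  have hr : r ^ 2 = 2 := by
    apply mul_left_cancel₀ (pow_ne_zero 2 hq)
    linear_combination h
  have hc : (constantCoeff r) ^ 2 = 2 := by
    rw [← map_pow, hr, map_ofNat]
  refine irrational_sqrt_two ⟨|constantCoeff r|, ?_⟩
  have hcast : ((constantCoeff r : ℚ) : ℝ) ^ 2 = 2 := by exact_mod_cast hc
  rw [Rat.cast_abs, ← Real.sqrt_sq_eq_abs, hcast]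

/-- A purely transcendental extension of `ℚ` inside `ℝ` does not contain `√2`. -/
theorem AlgIndepSet.sqrt_two_notMem_closure {S : Set ℝ} (hS : AlgIndepSet S) :
    √2 ∉ Subfield.closure S := by
  have key : ∀ y ∈ Subring.closure S,
      ∃ p : MvPolynomial S ℚ, MvPolynomial.aeval ((↑) : S → ℝ) p = y := fun y hy ↦
    (Subring.closure_le (t := (MvPolynomial.aeval (R := ℚ) ((↑) : S → ℝ)).range.toSubring)).2
      (fun s hs ↦ ⟨MvPolynomial.X ⟨s, hs⟩, MvPolynomial.aeval_X _ _⟩) hy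
  rw [Subfield.mem_closure_iff]
  rintro ⟨y, hy, z, hz, h⟩
  obtain ⟨p, rfl⟩ := key y hy
  obtain ⟨q, rfl⟩ := key z hz
  have hz0 : MvPolynomial.aeval ((↑) : S → ℝ) q ≠ 0 := by
    intro h0
    rw [h0, div_zero] at h
    exact (Real.sqrt_pos.2 two_pos).ne h
  refine MvPolynomial.sq_ne_two_mul_sq (p := p) (q := q) (fun h0 ↦ hz0 (by simp [h0])) (hS ?_)
  rw [div_eq_iff hz0] at h
  rw [map_mul, map_pow, map_pow, map_ofNat, h, mul_pow, Real.sq_sqrt zero_le_two]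

/-- A proper subfield containing a Bernstein set contains no Cantor set, since it is disjoint
from some translate of itself. -/
theorem IsBernsteinSet.not_isCantorSet_subset_subfield {B : Set ℝ} (hB : IsBernsteinSet B)
    {F : Subfield ℝ} (hBF : B ⊆ F) {t : ℝ} (ht : t ∉ F) : ¬ ∃ C ⊆ (F : Set ℝ), IsCantorSet C := by
  rintro ⟨C, hCF, hC⟩
  refine hB.2 ⟨_, ?_, hC.image_homeomorph (Homeomorph.addRight t)⟩
  rintro _ ⟨c, hc, rfl⟩ hcB
  exact ht ((add_mem_cancel_left (hCF hc)).1 (hBF hcB))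

theorem IsBernsteinSet.not_isCantorSet_subset_compl {B T : Set ℝ} (hB : IsBernsteinSet B)
    (hBT : B ⊆ T) : ¬ ∃ C ⊆ Tᶜ, IsCantorSet C := fun ⟨C, hCT, hC⟩ ↦
  hB.2 ⟨C, hCT.trans (compl_subset_compl.2 hBT), hC⟩

/-- If B is a Bernstein set and S ⊇ B is algebraically independent, then S is a
Bernstein set and ℚ(S) is a Bernstein field (in particular ℚ(S) ≠ ℝ). -/
theorem bernstein_of_algIndep_superset (B S : Set ℝ) (hB : IsBernsteinSet B)
    (hS : AlgIndepSet S) (hBS : B ⊆ S) :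
    IsBernsteinSet S ∧ Subfield.closure S ≠ ⊤ ∧
      IsBernsteinSet ((Subfield.closure S : Subfield ℝ) : Set ℝ) := by
  have hsqrt := hS.sqrt_two_notMem_closure
  have hSF : S ⊆ Subfield.closure S := Subfield.subset_closure
  have hF := hB.not_isCantorSet_subset_subfield (hBS.trans hSF) hsqrt
  refine ⟨⟨fun ⟨C, hCS, hC⟩ ↦ hF ⟨C, hCS.trans hSF, hC⟩, hB.not_isCantorSet_subset_compl hBS⟩,
    fun h ↦ hsqrt (h ▸ Subfield.mem_top _), hF,
    hB.not_isCantorSet_subset_compl (hBS.trans hSF)⟩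
end
end

section
/- If Y ⊆ ℝ is an algebraically independent set, then ∛2 ∉ ℚ(Y)*, where ℚ(Y)* is the smallest subfield L of ℝ containing ℚ(Y) such that √|x| ∈ L for every x ∈ L. -/
noncomputable section

open Set Cardinal

/-- `K*`: the smallest subfield `L` of ℝ with `K ⊆ L` such that `√|x| ∈ L` for every `x ∈ L`. -/
def starField (K : Subfield ℝ) : Subfield ℝ :=
  sInf {L : Subfield ℝ | K ≤ L ∧ ∀ x ∈ L, Real.sqrt |x| ∈ L}

/-- The real cube root of two is not a rational function of algebraically independent reals. -/
theorem cbrt_two_not_mem_closure {Y : Set ℝ} (hY : AlgIndepSet Y) {t : ℝ} (ht : t ^ 3 = 2) :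
    t ∉ Subfield.closure Y := by
  intro hmem
  have hpoly : ∀ x ∈ Subring.closure Y,
      ∃ p : MvPolynomial Y ℚ, MvPolynomial.aeval ((↑) : Y → ℝ) p = x := by
    intro x hx
    have hle : Subring.closure Y ≤
        (MvPolynomial.aeval (R := ℚ) ((↑) : Y → ℝ)).range.toSubring :=
      Subring.closure_le.2 fun y hy => ⟨MvPolynomial.X ⟨y, hy⟩, by simp⟩
    exact hle hx
  obtain ⟨x, hx, y, hy, hxy⟩ := Subfield.mem_closure_iff.1 hmem
  obtain ⟨p, rfl⟩ := hpoly x hx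
  obtain ⟨q, rfl⟩ := hpoly y hy
  have hq : MvPolynomial.aeval ((↑) : Y → ℝ) q ≠ 0 := by
    intro h
    rw [h, div_zero] at hxy
    norm_num [← hxy] at ht
  have hpq : p ^ 3 = q ^ 3 * 2 := by
    apply hY
    rw [← hxy, div_pow, div_eq_iff (pow_ne_zero 3 hq)] at ht
    simp only [map_pow, map_mul, map_ofNat]
    rw [ht, mul_comm]
  obtain ⟨c, rfl⟩ : q ∣ p :=
    (IsIntegrallyClosed.pow_dvd_pow_iff three_ne_zero).1 ⟨2, hpq⟩
  have hq0 : q ≠ 0 := by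
    rintro rfl
    simp at hq
  have hc : c ^ 3 = 2 := by
    rw [mul_pow] at hpq
    exact mul_left_cancel₀ (pow_ne_zero 3 hq0) hpq
  have hr : (MvPolynomial.eval (0 : Y → ℚ) c) ^ 3 = 2 := by
    rw [← map_pow, hc, map_ofNat]
  generalize MvPolynomial.eval (0 : Y → ℚ) c = r at hr
  obtain ⟨n, rfl⟩ : ∃ n : ℤ, (n : ℚ) = r := by
    have hint : IsIntegral ℤ r :=
      IsIntegral.of_pow (n := 3) (by norm_num) (by rw [hr]; exact isIntegral_algebraMap (x := (2 : ℤ)))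
    exact IsIntegrallyClosed.isIntegral_iff.1 hint
  have hn : n ^ 3 = 2 := by exact_mod_cast hr
  have h0 : 0 < n := by
    by_contra! h
    nlinarith [sq_nonneg n]
  have h1 : n < 2 := by
    by_contra! h
    nlinarith [sq_nonneg n]
  interval_cases n
  norm_num at hn

/-- Elements of a quadratic extension `M(s)` of a subfield of the reals have the form `x + y * s`. -/
theorem exists_eq_add_mul_of_mem_closure_insert {M : Subfield ℝ} {s : ℝ} (hs : s ∉ M)
    (hs2 : s ^ 2 ∈ M) {t : ℝ} (ht : t ∈ Subfield.closure (insert s (M : Set ℝ))) :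
    ∃ x ∈ M, ∃ y ∈ M, t = x + y * s := by
  induction ht using Subfield.closure_induction with
  | mem z hz =>
    rcases hz with rfl | hz
    · exact ⟨0, zero_mem M, 1, one_mem M, by ring⟩
    · exact ⟨z, hz, 0, zero_mem M, by ring⟩
  | one => exact ⟨1, one_mem M, 0, zero_mem M, by ring⟩
  | add _ _ _ _ h₁ h₂ =>
    obtain ⟨x, hx, y, hy, rfl⟩ := h₁
    obtain ⟨u, hu, v, hv, rfl⟩ := h₂
    exact ⟨x + u, add_mem hx hu, y + v, add_mem hy hv, by ring⟩
  | neg _ _ h =>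
    obtain ⟨x, hx, y, hy, rfl⟩ := h
    exact ⟨-x, neg_mem hx, -y, neg_mem hy, by ring⟩
  | inv _ _ h =>
    obtain ⟨x, hx, y, hy, rfl⟩ := h
    by_cases hy0 : y = 0
    · exact ⟨x⁻¹, inv_mem hx, 0, zero_mem M, by simp [hy0]⟩
    have hadd : x + y * s ≠ 0 := fun h => hs <| by
      rw [show s = -x / y by field_simp; linarith]
      exact div_mem (neg_mem hx) hy
    have hsub : x - y * s ≠ 0 := fun h => hs <| by
      rw [show s = x / y by field_simp; linarith]
      exact div_mem hx hy
    have hN : x ^ 2 - y ^ 2 * s ^ 2 ∈ M :=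
      sub_mem (pow_mem hx 2) (mul_mem (pow_mem hy 2) hs2)
    have hN0 : x ^ 2 - y ^ 2 * s ^ 2 ≠ 0 := by
      rw [show x ^ 2 - y ^ 2 * s ^ 2 = (x + y * s) * (x - y * s) by ring]
      exact mul_ne_zero hadd hsub
    refine ⟨x / (x ^ 2 - y ^ 2 * s ^ 2), div_mem hx hN,
      -y / (x ^ 2 - y ^ 2 * s ^ 2), div_mem (neg_mem hy) hN, ?_⟩
    refine inv_eq_of_mul_eq_one_right ?_
    rw [div_mul_eq_mul_div, ← add_div, mul_div_assoc', div_eq_one_iff_eq hN0]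
    ring
  | mul _ _ _ _ h₁ h₂ =>
    obtain ⟨x, hx, y, hy, rfl⟩ := h₁
    obtain ⟨u, hu, v, hv, rfl⟩ := h₂
    exact ⟨x * u + y * v * s ^ 2, add_mem (mul_mem hx hu) (mul_mem (mul_mem hy hv) hs2),
      x * v + y * u, add_mem (mul_mem hx hv) (mul_mem hy hu), by ring⟩

/-- Adjoining a real square root to a subfield of the reals adds no cube roots of its elements. -/
theorem mem_of_pow_three_mem_of_mem_closure_insert {M : Subfield ℝ} {s : ℝ} (hs2 : s ^ 2 ∈ M)
    {t : ℝ} (ht3 : t ^ 3 ∈ M) (ht : t ∈ Subfield.closure (insert s (M : Set ℝ))) : t ∈ M := by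
  by_cases hs : s ∈ M
  · rwa [Set.insert_eq_of_mem (show s ∈ (M : Set ℝ) from hs), Subfield.closure_eq] at ht
  obtain ⟨x, hx, y, hy, rfl⟩ := exists_eq_add_mul_of_mem_closure_insert hs hs2 ht
  -- The coefficient of `s` in the cube vanishes, so the cube is fixed by conjugation.
  have hB : y * (3 * x ^ 2 + y ^ 2 * s ^ 2) = 0 := by
    by_contra hB
    have h3 : (3 : ℝ) ∈ M := ofNat_mem M 3
    have hBM : y * (3 * x ^ 2 + y ^ 2 * s ^ 2) ∈ M :=
      mul_mem hy (add_mem (mul_mem h3 (pow_mem hx 2)) (mul_mem (pow_mem hy 2) hs2))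
    have hAM : x ^ 3 + 3 * x * y ^ 2 * s ^ 2 ∈ M :=
      add_mem (pow_mem hx 3) (mul_mem (mul_mem (mul_mem h3 hx) (pow_mem hy 2)) hs2)
    apply hs
    rw [show s = ((x + y * s) ^ 3 - (x ^ 3 + 3 * x * y ^ 2 * s ^ 2)) /
        (y * (3 * x ^ 2 + y ^ 2 * s ^ 2)) by rw [eq_div_iff hB]; ring]
    exact div_mem (sub_mem ht3 hAM) hBM
  have hconj : (x + y * s) ^ 3 = (x - y * s) ^ 3 := by linear_combination 2 * s * hB
  have hys : y * s = 0 := by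
    have := (Odd.strictMono_pow (R := ℝ) (n := 3) (by decide)).injective hconj
    linarith
  rwa [hys, add_zero]

/-- An element outside `K` whose cube lies in `K` stays outside the closure of `K` under real
square roots. -/
theorem not_mem_starField_of_pow_three_mem {K : Subfield ℝ} {t : ℝ} (ht3 : t ^ 3 ∈ K)
    (ht : t ∉ K) : t ∉ starField K := by
  obtain ⟨M, hKM, hM⟩ := zorn_le_nonempty₀ {L : Subfield ℝ | t ∉ L}
    (fun c hc hchain L hL => ⟨sSup c, fun hmem => by
      obtain ⟨N, hN, htN⟩ := (Subfield.mem_sSup_of_directedOn ⟨L, hL⟩ hchain.directedOn).1 hmem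
      exact hc hN htN, fun N hN => le_sSup hN⟩) K ht
  have hsqrt : ∀ x ∈ M, Real.sqrt |x| ∈ M := by
    intro x hx
    have hs2 : Real.sqrt |x| ^ 2 ∈ M := by
      rw [Real.sq_sqrt (abs_nonneg x)]
      rcases abs_choice x with h | h <;> rw [h]
      exacts [hx, neg_mem hx]
    have hle : M ≤ Subfield.closure (insert (Real.sqrt |x|) (M : Set ℝ)) :=
      fun y hy => Subfield.subset_closure (Set.mem_insert_of_mem _ hy)
    refine hM.le_of_ge (fun h => hM.prop ?_) hle
      (Subfield.subset_closure (Set.mem_insert _ _))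
    exact mem_of_pow_three_mem_of_mem_closure_insert hs2 (hKM ht3) h
  exact fun h => hM.prop (Subfield.mem_sInf.1 h M ⟨hKM, hsqrt⟩)

/-- If Y ⊆ ℝ is algebraically independent then ∛2 ∉ ℚ(Y)*. -/
theorem cbrt_two_not_mem_starField (Y : Set ℝ) (hY : AlgIndepSet Y) :
    (2 : ℝ) ^ ((1 : ℝ) / 3) ∉ starField (Subfield.closure Y) := by
  have ht : ((2 : ℝ) ^ ((1 : ℝ) / 3)) ^ 3 = 2 := by
    rw [← Real.rpow_natCast, ← Real.rpow_mul zero_le_two]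
    norm_num
  refine not_mem_starField_of_pow_three_mem ?_ (cbrt_two_not_mem_closure hY ht)
  rw [ht]
  exact ofNat_mem _ 2
end
end

section
/- If K is a subfield of ℝ and K* is the smallest subfield L of ℝ with K ⊆ L such that √|x| ∈ L for every x ∈ L, then every number in K* \ K is algebraic over K of degree 2ⁿ for some n ∈ ℕ, n ≥ 1 (i.e. its minimal polynomial over K has degree a power of 2 greater than 1). -/
noncomputable section

open Set Cardinal

namespace IntermediateField

variable {F E : Type*} [Field F] [Field E] [Algebra F E]

/-- `L` is obtained from `F` by successively adjoining finitely many square roots. -/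
inductive IsSqrtTower : IntermediateField F E → Prop
  | bot : IsSqrtTower ⊥
  | step (L : IntermediateField F E) (x : E) (hL : IsSqrtTower L) (hx : x ^ 2 ∈ L) :
      IsSqrtTower (L ⊔ adjoin F {x})

theorem isIntegral_of_sq_mem {L : IntermediateField F E} {x : E} (hx : x ^ 2 ∈ L) :
    IsIntegral L x :=
  IsIntegral.of_pow two_pos (isIntegral_algebraMap (x := (⟨x ^ 2, hx⟩ : L)))

theorem natDegree_minpoly_le_two_of_sq_mem {L : IntermediateField F E} {x : E}
    (hx : x ^ 2 ∈ L) : (minpoly L x).natDegree ≤ 2 := by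
  have hmonic : (Polynomial.X ^ 2 - Polynomial.C (⟨x ^ 2, hx⟩ : L)).Monic :=
    Polynomial.monic_X_pow_sub_C _ two_ne_zero
  have hroot : Polynomial.aeval x (Polynomial.X ^ 2 - Polynomial.C (⟨x ^ 2, hx⟩ : L)) = 0 := by
    simp [IntermediateField.algebraMap_apply]
  exact (Polynomial.natDegree_le_of_dvd (minpoly.dvd L x hroot) hmonic.ne_zero).trans
    (Polynomial.natDegree_X_pow_sub_C).le

theorem finrank_sup_adjoin_of_sq_mem {L : IntermediateField F E} {x : E} (hx : x ^ 2 ∈ L) :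
    Module.finrank F ↥(L ⊔ adjoin F {x}) = Module.finrank F L ∨
      Module.finrank F ↥(L ⊔ adjoin F {x}) = Module.finrank F L * 2 := by
  have hsup : L ⊔ adjoin F {x} = (adjoin L {x}).restrictScalars F := by
    rw [restrictScalars_adjoin, adjoin_union, adjoin_self]
  have hmul : Module.finrank F L * Module.finrank L (adjoin L {x}) =
      Module.finrank F ↥(L ⊔ adjoin F {x}) := by
    rw [hsup]
    exact Module.finrank_mul_finrank F L (adjoin L {x})
  have hint := isIntegral_of_sq_mem hx
  have hdeg := natDegree_minpoly_le_two_of_sq_mem hx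
  have hpos := minpoly.natDegree_pos hint
  rw [← hmul, adjoin.finrank hint]
  interval_cases (minpoly L x).natDegree <;> simp

theorem IsSqrtTower.finrank_eq_two_pow {L : IntermediateField F E} (hL : IsSqrtTower L) :
    ∃ n : ℕ, Module.finrank F L = 2 ^ n := by
  induction hL with
  | bot => exact ⟨0, by simp⟩
  | step L x _ hx ih =>
    obtain ⟨n, hn⟩ := ih
    rcases finrank_sup_adjoin_of_sq_mem hx with h | h
    · exact ⟨n, h.trans hn⟩
    · exact ⟨n + 1, by rw [h, hn, pow_succ]⟩

theorem IsSqrtTower.sup {L M : IntermediateField F E} (hL : IsSqrtTower L)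
    (hM : IsSqrtTower M) : IsSqrtTower (L ⊔ M) := by
  induction hM with
  | bot => simpa using hL
  | step M x _ hx ih =>
    rw [← sup_assoc]
    exact .step _ x ih ((le_sup_right : M ≤ L ⊔ M) hx)

theorem IsSqrtTower.isIntegral {L : IntermediateField F E} (hL : IsSqrtTower L) {x : E}
    (hx : x ∈ L) : IsIntegral F x := by
  obtain ⟨n, hn⟩ := hL.finrank_eq_two_pow
  have : FiniteDimensional F L := .of_finrank_pos (hn ▸ by positivity)
  exact (IsIntegral.of_finite F (⟨x, hx⟩ : L)).map L.val

theorem IsSqrtTower.natDegree_minpoly_eq_two_pow {L : IntermediateField F E}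
    (hL : IsSqrtTower L) {x : E} (hx : x ∈ L) :
    ∃ n : ℕ, (minpoly F x).natDegree = 2 ^ n := by
  obtain ⟨m, hm⟩ := hL.finrank_eq_two_pow
  have hdvd : (minpoly F x).natDegree ∣ 2 ^ m := by
    rw [← adjoin.finrank (hL.isIntegral hx), ← hm]
    exact finrank_dvd_of_le_right (adjoin_simple_le_iff.mpr hx)
  obtain ⟨n, -, hn⟩ := (Nat.dvd_prime_pow Nat.prime_two).mp hdvd
  exact ⟨n, hn⟩

variable (F E) in
/-- The elements lying in some field obtained from `F` by adjoining finitely many square roots. -/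
def sqrtClosure : Subfield E where
  carrier := {x | ∃ L : IntermediateField F E, IsSqrtTower L ∧ x ∈ L}
  mul_mem' := by
    rintro x y ⟨L, hL, hx⟩ ⟨M, hM, hy⟩
    exact ⟨L ⊔ M, hL.sup hM, mul_mem ((le_sup_left : L ≤ L ⊔ M) hx)
      ((le_sup_right : M ≤ L ⊔ M) hy)⟩
  add_mem' := by
    rintro x y ⟨L, hL, hx⟩ ⟨M, hM, hy⟩
    exact ⟨L ⊔ M, hL.sup hM, add_mem ((le_sup_left : L ≤ L ⊔ M) hx)
      ((le_sup_right : M ≤ L ⊔ M) hy)⟩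
  one_mem' := ⟨⊥, .bot, one_mem _⟩
  zero_mem' := ⟨⊥, .bot, zero_mem _⟩
  neg_mem' := fun ⟨L, hL, hx⟩ => ⟨L, hL, neg_mem hx⟩
  inv_mem' := fun _ ⟨L, hL, hx⟩ => ⟨L, hL, inv_mem hx⟩

theorem mem_sqrtClosure {x : E} :
    x ∈ sqrtClosure F E ↔ ∃ L : IntermediateField F E, IsSqrtTower L ∧ x ∈ L :=
  Iff.rfl

theorem algebraMap_mem_sqrtClosure (x : F) : algebraMap F E x ∈ sqrtClosure F E :=
  ⟨⊥, .bot, algebraMap_mem _ x⟩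

theorem mem_sqrtClosure_of_sq_mem {x : E} (hx : x ^ 2 ∈ sqrtClosure F E) :
    x ∈ sqrtClosure F E := by
  obtain ⟨L, hL, hxL⟩ := hx
  exact ⟨L ⊔ adjoin F {x}, .step L x hL hxL,
    (le_sup_right : adjoin F {x} ≤ L ⊔ adjoin F {x}) (mem_adjoin_simple_self F x)⟩

end IntermediateField

theorem starField_le_sqrtClosure (K : Subfield ℝ) :
    starField K ≤ IntermediateField.sqrtClosure K ℝ := by
  refine sInf_le ⟨fun x hx => IntermediateField.algebraMap_mem_sqrtClosure (⟨x, hx⟩ : K),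
    fun x hx => IntermediateField.mem_sqrtClosure_of_sq_mem ?_⟩
  rw [Real.sq_sqrt (abs_nonneg x)]
  rcases abs_choice x with h | h <;> rw [h]
  exacts [hx, neg_mem hx]

/-- Every number in K* \ K is algebraic over K of degree 2ⁿ, n ≥ 1. -/
theorem starField_degree_pow_two (K : Subfield ℝ) (x : ℝ)
    (hx : x ∈ starField K) (hxK : x ∉ K) :
    IsAlgebraic K x ∧ ∃ n : ℕ, 1 ≤ n ∧ (minpoly K x).natDegree = 2 ^ n := by
  obtain ⟨L, hL, hxL⟩ :=
    IntermediateField.mem_sqrtClosure.mp (starField_le_sqrtClosure K hx)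
  obtain ⟨n, hn⟩ := hL.natDegree_minpoly_eq_two_pow hxL
  refine ⟨(hL.isIntegral hxL).isAlgebraic, n, Nat.one_le_iff_ne_zero.mpr ?_, hn⟩
  rintro rfl
  obtain ⟨y, rfl⟩ := minpoly.natDegree_eq_one_iff.mp (by simpa using hn)
  exact hxK y.2
end
end

section
/- Every Cantor set D ⊆ ℝ contains an algebraically independent Cantor set; that is, there exists a Cantor set C ⊆ D such that C is algebraically independent over ℚ. -/
noncomputable section

open Set Cardinal

open Filter Topology

theorem countable_mvPolynomial (σ R : Type*) [Countable σ] [CommSemiring R] [Countable R] :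
    Countable (MvPolynomial σ R) := by
  rw [← Cardinal.mk_le_aleph0_iff]
  refine MvPolynomial.cardinalMk_le_max_lift.trans ?_
  simp [Cardinal.mk_le_aleph0]

/-- Choosing one point from each of finitely many uncountable sets of reals so that the chosen
points are algebraically independent. -/
theorem exists_algebraicIndependent_of_not_countable {ι : Type*} [Finite ι] (A : ι → Set ℝ)
    (hA : ∀ i, ¬ (A i).Countable) :
    ∃ d : ι → ℝ, (∀ i, d i ∈ A i) ∧ AlgebraicIndependent ℚ d := by
  induction ι using Finite.induction_empty_option with
  | @of_equiv α β e ih =>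
    obtain ⟨d, hd, hi⟩ := ih (A ∘ e) fun i ↦ hA (e i)
    exact ⟨d ∘ e.symm, fun i ↦ by simpa using hd (e.symm i), hi.comp _ e.symm.injective⟩
  | h_empty =>
    refine ⟨fun _ ↦ 0, fun i ↦ i.elim, ?_⟩
    rw [algebraicIndependent_empty_type_iff]
    exact (algebraMap ℚ ℝ).injective
  | @h_option α _ ih =>
    obtain ⟨d, hd, hi⟩ := ih (fun i ↦ A (some i)) fun i ↦ hA _
    have : Countable (Algebra.adjoin ℚ (range d)) := by
      have := countable_mvPolynomial α ℚ
      rw [Algebra.adjoin_range_eq_range_aeval]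
      exact (countable_range (MvPolynomial.aeval (R := ℚ) d)).to_subtype
    obtain ⟨a, haA, ha⟩ := not_subset.1 fun h ↦
      hA none ((Algebraic.countable (Algebra.adjoin ℚ (range d)) ℝ).mono h)
    refine ⟨fun o ↦ o.elim a d, ?_, (hi.option_iff_transcendental a).2 ha⟩
    rintro (_ | i)
    exacts [haA, hd i]

/-- A nonempty perfect subset of a complete metric space is uncountable. -/
theorem Perfect.not_countable {α : Type*} [MetricSpace α] [CompleteSpace α] {C : Set α}
    (hC : Perfect C) (hne : C.Nonempty) : ¬ C.Countable := by
  obtain ⟨f, hfC, -, hf⟩ := hC.exists_nat_bool_injection hne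
  intro h
  have := (h.mono hfC).to_subtype
  have := (rangeFactorization_injective.2 hf).countable
  have h' := Cardinal.mk_le_aleph0_iff.2 this
  simp only [Cardinal.mk_arrow, Cardinal.mk_bool, Cardinal.mk_nat, Cardinal.lift_id] at h'
  exact h'.not_gt (Cardinal.cantor ℵ₀)

theorem Perfect.not_countable_ball_inter {α : Type*} [MetricSpace α] [CompleteSpace α]
    {C : Set α} (hC : Perfect C) {x : α} (hx : x ∈ C) {ε : ℝ} (hε : 0 < ε) :
    ¬ (Metric.ball x ε ∩ C).Countable := by
  obtain ⟨hP, hne⟩ := hC.closure_nhds_inter x hx (Metric.mem_ball_self (half_pos hε))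
    Metric.isOpen_ball
  refine fun h ↦ hP.not_countable hne (h.mono (subset_inter ?_ ?_))
  · exact (closure_mono inter_subset_left).trans <| Metric.closure_ball_subset_closedBall.trans <|
      Metric.closedBall_subset_ball (half_lt_self hε)
  · exact closure_minimal inter_subset_right hC.closed

/-- A continuous function on the Cantor space is nearly constant on all cylinders of some
level. -/
theorem exists_forall_dist_lt_of_eq_on_initial {α : Type*} [PseudoMetricSpace α]
    {f : (ℕ → Bool) → α} (hf : Continuous f) (m : ℕ) {ε : ℝ} (hε : 0 < ε) :
    ∃ n ≥ m, ∀ x y, (∀ i < n, x i = y i) → dist (f x) (f y) < ε := by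
  by_contra! H
  let t : ℕ → Set ((ℕ → Bool) × (ℕ → Bool)) := fun n ↦
    {p | (∀ i < m + n, p.1 i = p.2 i) ∧ ε ≤ dist (f p.1) (f p.2)}
  have hcl : ∀ n, IsClosed (t n) := fun n ↦ by
    have ht : t n = (⋂ i < m + n, {p | p.1 i = p.2 i}) ∩ {p | ε ≤ dist (f p.1) (f p.2)} := by
      ext p
      simp [t]
    rw [ht]
    exact .inter (isClosed_biInter fun i _ ↦ isClosed_eq (by fun_prop) (by fun_prop))
      (isClosed_le (by fun_prop) (by fun_prop))
  obtain ⟨p, hp⟩ := IsCompact.nonempty_iInter_of_sequence_nonempty_isCompact_isClosed t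
    (fun n p hp ↦ ⟨fun i hi ↦ hp.1 i (by omega), hp.2⟩)
    (fun n ↦ by
      obtain ⟨x, y, h, h'⟩ := H (m + n) (by omega)
      exact ⟨(x, y), h, h'⟩)
    (hcl 0).isCompact hcl
  rw [mem_iInter] at hp
  have : p.1 = p.2 := funext fun i ↦ (hp (i + 1)).1 i (by omega)
  have h := (hp 0).2
  rw [this, dist_self] at h
  exact h.not_gt hε

/-- The sections of the map truncating points of the Cantor space to length `m`. -/
def truncationSections (m : ℕ) : Set ((Fin m → Bool) → ℕ → Bool) :=
  {x | ∀ s (i : Fin m), x s i = s i}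

theorem isCompact_truncationSections (m : ℕ) : IsCompact (truncationSections m) := by
  refine IsClosed.isCompact ?_
  simp only [truncationSections, ofPred_forall]
  exact isClosed_iInter fun s ↦ isClosed_iInter fun i ↦ isClosed_eq (by fun_prop) (by fun_prop)

/-- The maps which do not satisfy the relation `p` at points from the distinct cylinders of
level `m`. -/
def avoidingMaps (D : Set ℝ) (m : ℕ) (p : MvPolynomial (Fin m → Bool) ℚ) :
    Set C(ℕ → Bool, D) :=
  {f | ∀ x ∈ truncationSections m, MvPolynomial.aeval (fun s ↦ (f (x s) : ℝ)) p ≠ 0}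

theorem isOpen_avoidingMaps (D : Set ℝ) (m : ℕ) (p : MvPolynomial (Fin m → Bool) ℚ) :
    IsOpen (avoidingMaps D m p) := by
  have hc : Continuous fun z : C(ℕ → Bool, D) × ((Fin m → Bool) → ℕ → Bool) ↦
      MvPolynomial.aeval (fun s ↦ (z.1 (z.2 s) : ℝ)) p := by
    simp only [MvPolynomial.aeval_def, MvPolynomial.eval₂_eq_eval_map]
    refine (MvPolynomial.continuous_eval _).comp (continuous_pi fun s ↦ ?_)
    exact continuous_subtype_val.comp
      (continuous_fst.eval ((continuous_apply s).comp continuous_snd))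
  refine isOpen_iff_eventually.2 fun f hf ↦ ?_
  refine (isCompact_truncationSections m).eventually_forall_of_forall_eventually fun x hx ↦ ?_
  exact hc.continuousAt.eventually_ne (hf x hx)

theorem dense_avoidingMaps {D : Set ℝ} (hD : Perfect D) (m : ℕ)
    {p : MvPolynomial (Fin m → Bool) ℚ} (hp : p ≠ 0) : Dense (avoidingMaps D m p) := by
  rw [Metric.dense_iff]
  intro f ε hε
  obtain ⟨n, hmn, hn⟩ := exists_forall_dist_lt_of_eq_on_initial f.continuous m (half_pos hε)
  let e : (Fin n → Bool) → ℕ → Bool := fun s i ↦ if h : i < n then s ⟨i, h⟩ else false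
  obtain ⟨d, hd, hi⟩ := exists_algebraicIndependent_of_not_countable
    (fun s ↦ Metric.ball (f (e s) : ℝ) (ε / 2) ∩ D)
    fun s ↦ hD.not_countable_ball_inter (f (e s)).2 (half_pos hε)
  let r : (ℕ → Bool) → Fin n → Bool := fun x i ↦ x i
  let g : C(ℕ → Bool, D) :=
    ⟨fun x ↦ ⟨d (r x), (hd _).2⟩,
      (continuous_of_discreteTopology (f := fun s ↦ (⟨d s, (hd s).2⟩ : D))).comp
        (by fun_prop : Continuous r)⟩
  refine ⟨g, ?_, fun x hx h ↦ hp ?_⟩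
  · rw [Metric.mem_ball, ContinuousMap.dist_lt_iff hε]
    intro x
    calc dist (g x) (f x) ≤ dist (g x) (f (e (r x))) + dist (f (e (r x))) (f x) :=
          dist_triangle _ _ _
      _ < ε / 2 + ε / 2 :=
          add_lt_add (hd (r x)).1 (hn _ _ fun i hi ↦ by simp [e, r, hi])
      _ = ε := add_halves ε
  · have hinj : Function.Injective (r ∘ x) := fun s t hst ↦ funext fun i ↦ by
      have := congrFun hst (Fin.castLE hmn i)
      simpa [r, hx s i, hx t i] using this
    exact (injective_iff_map_eq_zero _).1 (hi.comp _ hinj) p h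

/-- A family indexed by the Cantor space is algebraically independent if all its subfamilies
picking one point from each cylinder of a given level are. -/
theorem algebraicIndependent_of_truncationSections {f : (ℕ → Bool) → ℝ}
    (hf : ∀ m, ∀ x ∈ truncationSections m, AlgebraicIndependent ℚ fun s ↦ f (x s)) :
    AlgebraicIndependent ℚ f := by
  refine algebraicIndependent_of_finite_type fun t ht ↦ ?_
  obtain ⟨m, hm⟩ : ∃ m, ∀ x ∈ t, ∀ y ∈ t, (∀ i < m, x i = y i) → x = y := by
    have h (q : (ℕ → Bool) × (ℕ → Bool)) :
        ∃ m, (∀ i < m, q.1 i = q.2 i) → q.1 = q.2 := by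
      by_cases hq : q.1 = q.2
      · exact ⟨0, fun _ ↦ hq⟩
      · obtain ⟨i, hi⟩ := Function.ne_iff.1 hq
        exact ⟨i + 1, fun h ↦ (hi (h i i.lt_succ_self)).elim⟩
    choose M hM using h
    obtain ⟨m, hm⟩ := ((ht.prod ht).image M).bddAbove
    exact ⟨m, fun x hx y hy h ↦ hM (x, y) fun i hi ↦
      h i (hi.trans_le (hm ⟨(x, y), ⟨hx, hy⟩, rfl⟩))⟩
  let r : t → Fin m → Bool := fun x i ↦ x.1 i
  have hr : Function.Injective r := fun x y h ↦ Subtype.ext <|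
    hm x x.2 y y.2 fun i hi ↦ congrFun h ⟨i, hi⟩
  let e : (Fin m → Bool) → ℕ → Bool := fun s i ↦ if h : i < m then s ⟨i, h⟩ else false
  let x : (Fin m → Bool) → ℕ → Bool := Function.extend r Subtype.val e
  have hx : x ∈ truncationSections m := fun s i ↦ by
    by_cases h : ∃ a, r a = s
    · obtain ⟨a, rfl⟩ := h
      simp [x, hr.extend_apply, r]
    · simp [x, Function.extend_apply' _ _ _ h, e]
  have h := (hf m x hx).comp r hr
  have hxr : (fun s ↦ f (x s)) ∘ r = fun a : t ↦ f a := funext fun a ↦ by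
    simp [x, hr.extend_apply]
  rwa [hxr] at h

theorem preperfect_range_of_injective {α : Type*} [TopologicalSpace α] {f : (ℕ → Bool) → α}
    (hf : Continuous f) (hinj : Function.Injective f) : Preperfect (range f) := by
  rw [preperfect_iff_nhds]
  rintro _ ⟨x, rfl⟩ U hU
  have ht : Tendsto (fun n ↦ Function.update x n (!x n)) atTop (𝓝 x) :=
    tendsto_pi_nhds.2 fun i ↦ tendsto_const_nhds.congr' <|
      (eventually_gt_atTop i).mono fun n hn ↦ by simp [Function.update_of_ne hn.ne]
  obtain ⟨n, hn⟩ := (ht.eventually (hf.continuousAt hU)).exists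
  refine ⟨_, ⟨hn, mem_range_self _⟩, fun h ↦ ?_⟩
  simpa using congrFun (hinj h) n

/-- Every Cantor set contains an algebraically independent Cantor set. -/
theorem cantorSet_contains_algIndep_cantorSet (D : Set ℝ) (hD : IsCantorSet D) :
    ∃ C ⊆ D, IsCantorSet C ∧ AlgIndepSet C := by
  obtain ⟨⟨a, ha⟩, hcomp, htd, hpre⟩ := hD
  have hperf : Perfect D := ⟨hcomp.isClosed, hpre⟩
  have : CompactSpace D := isCompact_iff_compactSpace.1 hcomp
  have : Nonempty C(ℕ → Bool, D) := ⟨.const _ ⟨a, ha⟩⟩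
  have (m : ℕ) : Countable (MvPolynomial (Fin m → Bool) ℚ) :=
    countable_mvPolynomial _ _
  obtain ⟨f, hf⟩ := (dense_iInter_of_isOpen
    (f := fun q : Σ m : ℕ, {p : MvPolynomial (Fin m → Bool) ℚ // p ≠ 0} ↦
      avoidingMaps D q.1 q.2.1)
    (fun q ↦ isOpen_avoidingMaps D q.1 q.2.1)
    fun q ↦ dense_avoidingMaps hperf q.1 q.2.2).nonempty
  rw [mem_iInter] at hf
  have hind : AlgebraicIndependent ℚ fun x ↦ (f x : ℝ) :=
    algebraicIndependent_of_truncationSections fun m x hx ↦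
      (injective_iff_map_eq_zero _).2 fun p hp ↦ by
        by_contra hne
        exact hf ⟨m, p, hne⟩ x hx hp
  have hcont : Continuous fun x ↦ (f x : ℝ) := by fun_prop
  have hsub : range (fun x ↦ (f x : ℝ)) ⊆ D := by
    rintro _ ⟨x, rfl⟩
    exact (f x).2
  exact ⟨_, hsub, ⟨range_nonempty _, isCompact_range hcont, fun t ht ↦ htd t (ht.trans hsub),
    preperfect_range_of_injective hcont hind.injective⟩, hind.coe_range⟩
end
end
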